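/- There exists a real-valued φ ∈ L²(𝕋), not almost everywhere zero, and a nonzero f ∈ ℓ²(ℕ, ℂ) such that f ∈ Dom T_φ and T_φ f = 0. Consequently, for this φ the finitely supported sequences are not dense in Dom T_φ with respect to the graph norm, i.e. [T_φ]_max ≠ [T_φ]_min (Hartman–Wintner). -/

import Mathlib

open scoped ComplexConjugate
open Filter MeasureTheory AddCircle

noncomputable section

instance : Fact (0 < 2 * Real.pi) := ⟨by positivity⟩

/-- `ℓ²(ℕ, ℂ)`. -/
abbrev ellTwo : Type := lp (fun _ : ℕ => ℂ) 2

/-- Finitely supported sequences. -/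
def FinSupp (p : ℕ → ℂ) : Prop := ∃ N, ∀ n ≥ N, p n = 0

/-- The (maximal) Toeplitz matrix action with symbol coefficients `a : ℤ → ℂ`:
`(T f)(j) = ∑_k a(j−k) f(k)`. -/
def toeplitz (a : ℤ → ℂ) (f : ℕ → ℂ) : ℕ → ℂ :=
  fun j => ∑' k : ℕ, a ((j : ℤ) - (k : ℤ)) * f k

/-- The backward shift of a square-summable sequence. -/
def backwardShift (q : ellTwo) : ellTwo :=
  ⟨fun i => q (i + 1), by
    have h := (memℓp_gen_iff (by norm_num)).1 (lp.memℓp q)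
    exact (memℓp_gen_iff (by norm_num)).2 (h.comp_injective (add_left_injective 1))⟩

lemma norm_backwardShift_le (q : ellTwo) : ‖backwardShift q‖ ≤ ‖q‖ := by
  have h := (memℓp_gen_iff (by norm_num)).1 (lp.memℓp q)
  refine lp.norm_le_of_tsum_le (by norm_num) (norm_nonneg _) ?_
  rw [lp.norm_rpow_eq_tsum (by norm_num) q, h.tsum_eq_zero_add]
  exact le_add_of_nonneg_left (by positivity)

/-- If the Toeplitz matrix with Hermitian coefficients kills `f`, and maps the forward shift of `f`
to a nonzero multiple of the first basis vector, and if `f 0 ≠ 0`, then `f` is not in the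
graph-norm closure of the finitely supported sequences. -/
lemma not_dense_of_shift_kernel (a : ℤ → ℂ) (ha : ∀ n, a (-n) = conj (a n)) (f : ellTwo)
    (hf0 : f 0 ≠ 0) (hf : toeplitz a f = 0) (c : ℂ) (hc : c ≠ 0)
    (hsum : ∀ j : ℕ, HasSum (fun k : ℕ => a ((j : ℤ) - 1 - k) * f k) (if j = 0 then c else 0)) :
    ¬ (∀ (f : ellTwo) (hf : Memℓp (toeplitz a (⇑f)) 2)
          (ε : ℝ), 0 < ε →
          ∃ (p : ellTwo) (_ : FinSupp (⇑p))
            (hp : Memℓp (toeplitz a (⇑p)) 2),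
            ‖f - p‖ ^ 2 +
              ‖(⟨toeplitz a (⇑f), hf⟩ : ellTwo) -
                (⟨toeplitz a (⇑p), hp⟩ : ellTwo)‖ ^ 2 < ε ^ 2) := by
  intro H
  have hmem : Memℓp (toeplitz a (⇑f)) 2 := by rw [hf]; exact zero_memℓp
  have hf0' : 0 < ‖f 0‖ := norm_pos_iff.2 hf0
  have hc' : 0 < ‖c‖ := norm_pos_iff.2 hc
  have hden : 0 < ‖f‖ + ‖c‖ := by positivity
  have hε : 0 < ‖f 0‖ * ‖c‖ / (‖f‖ + ‖c‖) := by positivity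
  obtain ⟨p, ⟨N, hN⟩, hp, hlt⟩ := H f hmem _ hε
  set ε := ‖f 0‖ * ‖c‖ / (‖f‖ + ‖c‖) with hεdef
  have hεmul : ε * (‖f‖ + ‖c‖) = ‖f 0‖ * ‖c‖ := by rw [hεdef]; field_simp
  set q : ellTwo := ⟨toeplitz a (⇑p), hp⟩ with hq
  have hz : (⟨toeplitz a (⇑f), hmem⟩ : ellTwo) = 0 := by
    ext i; exact congrFun hf i
  rw [hz, zero_sub, norm_neg] at hlt
  have h1 : ‖f - p‖ < ε := lt_of_pow_lt_pow_left₀ 2 hε.le (by nlinarith [sq_nonneg ‖q‖])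
  have h2 : ‖q‖ < ε := lt_of_pow_lt_pow_left₀ 2 hε.le (by nlinarith [sq_nonneg ‖f - p‖])
  have h3 : ‖f 0 - p 0‖ ≤ ‖f - p‖ := lp.norm_apply_le_norm (by norm_num) (f - p) 0
  have hqv : ∀ j, q j = ∑ k ∈ Finset.range N, a ((j : ℤ) - k) * p k := fun j =>
    tsum_eq_sum fun k hk => by
      rw [hN k (by simpa using hk), mul_zero]
  have hcol : ∀ k : ℕ, HasSum (fun i : ℕ => p k * (a (((i + 1 : ℕ) : ℤ) - k) * conj (f i)))
      (p k * conj (if k = 0 then c else 0)) := fun k => by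
    refine HasSum.mul_left _ ?_
    refine (Complex.hasSum_conj'.2 (hsum k)).congr_fun fun i => ?_
    rw [map_mul, ← ha]
    congr 2
    push_cast
    ring
  have hS : HasSum (fun i : ℕ => q (i + 1) * conj (f i))
      (∑ k ∈ Finset.range N, p k * conj (if k = 0 then c else 0)) := by
    convert hasSum_sum (s := Finset.range N) fun k _ => hcol k using 2 with i
    rw [hqv, Finset.sum_mul]
    exact Finset.sum_congr rfl fun k _ => by ring
  have hval : ∑ k ∈ Finset.range N, p k * conj (if k = 0 then c else 0) = p 0 * conj c := by
    rw [Finset.sum_eq_single 0]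
    · simp
    · intro k _ hk; simp [hk]
    · intro h
      rw [hN 0 (by simpa using h), zero_mul]
  have hinner := lp.hasSum_inner (𝕜 := ℂ) f (backwardShift q)
  have heq : inner ℂ f (backwardShift q) = p 0 * conj c := by
    rw [← hval]
    exact hinner.unique hS
  have h4 : ‖p 0‖ * ‖c‖ ≤ ‖f‖ * ‖q‖ := by
    calc ‖p 0‖ * ‖c‖ = ‖p 0 * conj c‖ := by rw [norm_mul, RCLike.norm_conj]
      _ ≤ ‖f‖ * ‖backwardShift q‖ := by rw [← heq]; exact norm_inner_le_norm _ _
      _ ≤ _ := by gcongr; exact norm_backwardShift_le q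
  have h5 : ‖f 0‖ ≤ ‖f 0 - p 0‖ + ‖p 0‖ := by simpa using norm_add_le (f 0 - p 0) (p 0)
  have h6 : ‖f‖ * ‖q‖ ≤ ‖f‖ * ε := by gcongr
  have h7 : ‖f 0‖ * ‖c‖ < (ε + ‖p 0‖) * ‖c‖ := by gcongr; linarith
  nlinarith

local notation "𝕋" => AddCircle (2 * Real.pi)
local notation "ν𝕋" => haarAddCircle (T := 2 * Real.pi)

lemma norm_fourier_apply (n : ℤ) (x : 𝕋) : ‖fourier n x‖ = 1 := by
  rw [fourier_apply, Circle.norm_coe]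

lemma fourier_natCast_mul (n : ℕ) (x : 𝕋) : fourier (n : ℤ) x = fourier 1 x ^ n := by
  induction n with
  | zero => simp
  | succ n ih => rw [Nat.cast_succ, fourier_add, ih, pow_succ]

lemma fourier_one_coe (θ : ℝ) : fourier 1 (θ : 𝕋) = circleMap 0 1 θ := by
  rw [fourier_coe_apply, circleMap]
  have : (Real.pi : ℂ) ≠ 0 := by exact_mod_cast Real.pi_ne_zero
  simp only [Complex.ofReal_one, one_mul, zero_add, Int.cast_one, mul_one]
  congr 1
  push_cast
  field_simp

lemma one_sub_sq_eq {z : ℂ} (hz : ‖z‖ = 1) : 1 - z ^ 2 = -z * ((2 * z.im : ℝ) * Complex.I) := by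
  have h : z * conj z = 1 := by rw [Complex.mul_conj, Complex.normSq_eq_norm_sq, hz]; simp
  have h2 := Complex.sub_conj z
  rw [← h2]
  linear_combination -h

lemma norm_one_sub_sq {z : ℂ} (hz : ‖z‖ = 1) : ‖1 - z ^ 2‖ = |2 * z.im| := by
  rw [one_sub_sq_eq hz, norm_mul, norm_neg, hz, norm_mul, Complex.norm_I, Complex.norm_real,
    one_mul, mul_one, Real.norm_eq_abs]

lemma intervalIntegrable_abs_sin_rpow {β : ℝ} (h0 : 0 < β) (h1 : β < 1) (a b : ℝ) :
    IntervalIntegrable (fun θ => |2 * Real.sin θ| ^ (-β)) volume a b := by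
  have hper : Function.Periodic (fun θ => |2 * Real.sin θ| ^ (-β)) Real.pi := fun θ => by
    simp [Real.sin_add_pi]
  refine hper.intervalIntegrable (t := -(Real.pi / 2)) Real.pi_ne_zero ?_ a b
  have hmeas : Measurable (fun θ => |2 * Real.sin θ| ^ (-β)) := by fun_prop
  have hpi := Real.pi_pos
  have key : IntervalIntegrable (fun θ => |2 * Real.sin θ| ^ (-β)) volume 0 (Real.pi / 2) := by
    refine (intervalIntegral.intervalIntegrable_rpow' (r := -β) (by linarith)).mono_fun
      hmeas.aestronglyMeasurable ?_
    rw [Filter.EventuallyLE, ae_restrict_iff' measurableSet_uIoc]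
    refine ae_of_all _ fun x hx => ?_
    rw [Set.uIoc_of_le (by positivity)] at hx
    have hs := Real.mul_le_sin hx.1.le hx.2
    have h3 : x ≤ |2 * Real.sin x| := by
      refine le_trans ?_ (le_abs_self _)
      have : x ≤ 2 * (2 / Real.pi * x) := by
        have h4 := Real.pi_le_four
        have hx0 := hx.1
        have : 1 ≤ 4 / Real.pi := by rw [le_div_iff₀ hpi]; linarith
        calc x ≤ (4 / Real.pi) * x := by nlinarith
          _ = _ := by ring
      linarith
    rw [Real.norm_of_nonneg (by positivity), Real.norm_of_nonneg (Real.rpow_nonneg hx.1.le _)]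
    exact Real.rpow_le_rpow_of_nonpos hx.1 h3 (by linarith)
  have hneg := ((IntervalIntegrable.iff_comp_neg (by finiteness)).1 key).symm
  simp only [Real.sin_neg, mul_neg, abs_neg, neg_zero] at hneg
  convert hneg.trans key using 1
  ring

lemma integrable_of_intervalIntegrable {g : 𝕋 → ℝ} (hg : Measurable g)
    (h : IntervalIntegrable (fun θ : ℝ => g θ) volume 0 (2 * Real.pi)) : Integrable g ν𝕋 := by
  have hv : Integrable g (volume : Measure 𝕋) := by
    rw [← (AddCircle.measurePreserving_mk (2 * Real.pi) 0).integrable_comp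
      hg.aestronglyMeasurable, zero_add]
    exact (intervalIntegrable_iff_integrableOn_Ioc_of_le (by positivity)).1 h
  rw [volume_eq_smul_haarAddCircle] at hv
  exact (integrable_smul_measure (by simpa using Real.pi_pos) ENNReal.ofReal_ne_top).1 hv

/-- Twice the sine, as a function on the circle. -/
def twoSin (x : 𝕋) : ℝ := 2 * (fourier 1 x).im

lemma measurable_twoSin : Measurable twoSin := by
  unfold twoSin
  have : Continuous (fun x : 𝕋 => fourier 1 x) := by fun_prop
  fun_prop

lemma twoSin_coe (θ : ℝ) : twoSin (θ : 𝕋) = 2 * Real.sin θ := by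
  rw [twoSin, fourier_one_coe, circleMap_zero]
  simp [Complex.exp_ofReal_mul_I_im]

lemma integrable_abs_twoSin_rpow {β : ℝ} (h0 : 0 < β) (h1 : β < 1) :
    Integrable (fun x => |twoSin x| ^ (-β)) ν𝕋 := by
  refine integrable_of_intervalIntegrable ?_ ?_
  · have := measurable_twoSin
    fun_prop
  · simpa only [twoSin_coe] using intervalIntegrable_abs_sin_rpow h0 h1 _ _

lemma ae_twoSin_ne_zero : ∀ᵐ x ∂ν𝕋, twoSin x ≠ 0 := by
  have hfin : {x : 𝕋 | twoSin x = 0}.Finite := by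
    refine ((Set.toFinite {(1 : ℂ), -1}).preimage (f := fun x : 𝕋 => fourier 1 x) ?_).subset ?_
    · intro x _ y _ hxy
      simp only [fourier_one] at hxy
      exact injective_toCircle (by positivity) (Circle.ext hxy)
    · intro x hx
      have h := one_sub_sq_eq (norm_fourier_apply 1 x)
      change (2 * (fourier 1 x).im : ℝ) = 0 at hx
      rw [hx, Complex.ofReal_zero, zero_mul, mul_zero, sub_eq_zero] at h
      have h2 := sq_eq_sq_iff_eq_or_eq_neg.1 (h.symm.trans (one_pow 2).symm)
      simpa using h2
  have : NullSingletonClass ν𝕋 := ⟨fun x => by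
    have hv := AddCircle.volume_closedBall (2 * Real.pi) (x := x) 0
    rw [Metric.closedBall_zero, volume_eq_smul_haarAddCircle] at hv
    simpa [Real.pi_pos.le, Real.pi_pos.not_ge] using hv⟩
  have h := hfin.measure_zero ν𝕋
  exact measure_eq_zero_iff_ae_notMem.1 h

/-- The function `(1 - z²)^(-α)`, holomorphic in the unit disc. -/
def K (α : ℝ) (z : ℂ) : ℂ := (1 - z ^ 2) ^ (-α : ℂ)

lemma integral_fourier_mul_K_radial (α : ℝ) {r : ℝ} (hr0 : 0 < r) (hr1 : r < 1) (n : ℕ) :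
    ∫ x, fourier 1 x ^ n * K α (r * fourier 1 x) ∂ν𝕋 = if n = 0 then 1 else 0 := by
  have hd : DifferentiableOn ℂ (fun z => z ^ n * K α (r * z)) (Metric.closedBall 0 1) := by
    intro z hz
    have hz1 : ‖z‖ ≤ 1 := by simpa using hz
    have hslit : 1 - (r * z) ^ 2 ∈ Complex.slitPlane := by
      left
      have : ‖(r * z) ^ 2‖ < 1 := by
        rw [norm_pow, norm_mul, Complex.norm_real, Real.norm_of_nonneg hr0.le]
        have : r * ‖z‖ < 1 := by nlinarith [norm_nonneg z]
        exact pow_lt_one₀ (by positivity) this (by norm_num)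
      have h2 := Complex.re_le_norm ((r * z) ^ 2)
      rw [Complex.sub_re, Complex.one_re]
      linarith
    unfold K
    refine DifferentiableAt.differentiableWithinAt ?_
    exact (differentiableAt_id.pow n).mul
      (DifferentiableAt.cpow (by fun_prop) (by fun_prop) hslit)
  have hdc : DiffContOnCl ℂ (fun z => z ^ n * K α (r * z)) (Metric.ball 0 |1|) := by
    refine DifferentiableOn.diffContOnCl ?_
    rw [abs_one, closure_ball _ one_ne_zero]
    exact hd
  have h := hdc.circleAverage
  have hint : ∫ x, fourier 1 x ^ n * K α (r * fourier 1 x) ∂ν𝕋 =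
      fourierCoeff (fun x : 𝕋 => fourier 1 x ^ n * K α (r * fourier 1 x)) 0 := by
    simp [fourierCoeff]
  rw [hint, fourierCoeff_eq_intervalIntegral _ _ 0]
  rw [Real.circleAverage] at h
  simp only [neg_zero, fourier_zero, one_smul, zero_add, one_div, fourier_one_coe]
  rw [h]
  by_cases hn : n = 0 <;> simp [hn, K]

lemma norm_cpow_neg_ofReal {w : ℂ} {α : ℝ} (hw : w ≠ 0) :
    ‖w ^ (-α : ℂ)‖ = ‖w‖ ^ (-α) := by
  have := Complex.norm_cpow_of_ne_zero hw (-α : ℂ)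
  simpa using this

lemma norm_K {α : ℝ} {x : 𝕋} (hx : twoSin x ≠ 0) :
    ‖K α (fourier 1 x)‖ = |twoSin x| ^ (-α) := by
  have hn := norm_one_sub_sq (norm_fourier_apply 1 x)
  have hw : 1 - (fourier 1 x) ^ 2 ≠ 0 := by
    rw [← norm_ne_zero_iff, hn]; exact abs_ne_zero.2 hx
  rw [K, norm_cpow_neg_ofReal hw, hn, twoSin]

lemma measurable_K (α : ℝ) (r : ℝ) : Measurable (fun x : 𝕋 => K α (r * fourier 1 x)) := by
  have : Continuous (fun x : 𝕋 => fourier 1 x) := by fun_prop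
  unfold K
  fun_prop

lemma measurable_K_fourier (α : ℝ) : Measurable (fun x : 𝕋 => K α (fourier 1 x)) := by
  simpa using measurable_K α 1

lemma norm_one_sub_sq_le {z : ℂ} (hz : ‖z‖ = 1) {r : ℝ} (hr0 : 0 < r) (hr1 : r < 1) :
    ‖1 - z ^ 2‖ ≤ 2 * ‖1 - (r * z) ^ 2‖ := by
  have h1 : ‖(1 - z ^ 2) - (1 - (r * z) ^ 2)‖ = 1 - r ^ 2 := by
    have : (1 - z ^ 2) - (1 - (r * z) ^ 2) = ((-(1 - r ^ 2) : ℝ) : ℂ) * z ^ 2 := by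
      push_cast; ring
    rw [this, norm_mul, norm_pow, hz, Complex.norm_real, norm_neg, Real.norm_of_nonneg]
    · ring
    · nlinarith
  have h2 : 1 - r ^ 2 ≤ ‖1 - (r * z) ^ 2‖ := by
    have h3 := norm_sub_norm_le (1 : ℂ) ((r * z) ^ 2)
    rw [norm_pow, norm_mul, hz, Complex.norm_real, Real.norm_of_nonneg hr0.le, norm_one,
      mul_one] at h3
    exact h3
  have h4 := norm_add_le ((1 - z ^ 2) - (1 - (r * z) ^ 2)) (1 - (r * z) ^ 2)
  rw [sub_add_cancel, h1] at h4
  linarith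

lemma integral_fourier_mul_K {α : ℝ} (h0 : 0 < α) (h1 : α < 1) (n : ℕ) :
    ∫ x, fourier 1 x ^ n * K α (fourier 1 x) ∂ν𝕋 = if n = 0 then 1 else 0 := by
  have hcont : Continuous (fun x : 𝕋 => fourier 1 x) := by fun_prop
  let r : ℕ → ℝ := fun m => 1 - 1 / ((m : ℝ) + 2)
  have hr0 : ∀ m, 0 < r m := fun m => by
    have : 1 / ((m : ℝ) + 2) < 1 := by
      rw [div_lt_one (by positivity)]
      linarith [(m.cast_nonneg : (0 : ℝ) ≤ m)]
    simp only [r]; linarith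
  have hr1 : ∀ m, r m < 1 := fun m => by
    have : 0 < 1 / ((m : ℝ) + 2) := by positivity
    simp only [r]; linarith
  have hrt : Tendsto r atTop (nhds 1) := by
    have h := (tendsto_one_div_add_atTop_nhds_zero_nat (𝕜 := ℝ)).comp (tendsto_add_atTop_nat 1)
    have h' : Tendsto (fun m : ℕ => 1 - 1 / (((m + 1 : ℕ) : ℝ) + 1)) atTop (nhds (1 - 0)) :=
      h.const_sub 1
    rw [sub_zero] at h'
    refine h'.congr fun m => ?_
    simp only [r]; push_cast; ring
  have hlim := tendsto_integral_of_dominated_convergence (μ := ν𝕋)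
    (F := fun m x => fourier 1 x ^ n * K α (r m * fourier 1 x))
    (f := fun x => fourier 1 x ^ n * K α (fourier 1 x))
    (fun x => 2 ^ α * |twoSin x| ^ (-α))
    (fun m => ((hcont.measurable.pow_const n).mul (measurable_K α (r m))).aestronglyMeasurable)
    ((integrable_abs_twoSin_rpow h0 h1).const_mul _) ?_ ?_
  · simp only [integral_fourier_mul_K_radial α (hr0 _) (hr1 _)] at hlim
    exact tendsto_nhds_unique hlim tendsto_const_nhds
  · intro m
    filter_upwards [ae_twoSin_ne_zero] with x hx
    have hz := norm_fourier_apply 1 x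
    have hle := norm_one_sub_sq_le hz (hr0 m) (hr1 m)
    rw [norm_one_sub_sq hz] at hle
    have hpos : 0 < |twoSin x| := abs_pos.2 hx
    change |twoSin x| ≤ _ at hle
    have hw : (1 - (r m * fourier 1 x) ^ 2 : ℂ) ≠ 0 := by
      rw [← norm_pos_iff]; linarith
    rw [norm_mul, norm_pow, hz, one_pow, one_mul, K, norm_cpow_neg_ofReal hw]
    calc ‖(1 - (r m * fourier 1 x) ^ 2 : ℂ)‖ ^ (-α) ≤ (|twoSin x| / 2) ^ (-α) :=
          Real.rpow_le_rpow_of_nonpos (by positivity) (by linarith) (by linarith)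
      _ = 2 ^ α * |twoSin x| ^ (-α) := by
          rw [Real.div_rpow hpos.le (by norm_num), Real.rpow_neg (by norm_num : (0:ℝ) ≤ 2)]
          field_simp
  · filter_upwards [ae_twoSin_ne_zero] with x hx
    have hz := norm_fourier_apply 1 x
    refine Tendsto.const_mul _ ?_
    have hslit : 1 - (fourier 1 x) ^ 2 ∈ Complex.slitPlane := by
      have him : (fourier 1 x).im ≠ 0 := fun h => hx (by rw [twoSin, h, mul_zero])
      left
      have hsq : (fourier 1 x).re ^ 2 + (fourier 1 x).im ^ 2 = 1 := by
        have := Complex.normSq_eq_norm_sq (fourier 1 x)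
        rw [hz, Complex.normSq_apply] at this
        linarith
      have : (1 - (fourier 1 x) ^ 2 : ℂ).re = 2 * (fourier 1 x).im ^ 2 := by
        rw [pow_two, Complex.sub_re, Complex.mul_re, Complex.one_re]; linarith
      rw [this]
      positivity
    have hca : ContinuousAt (fun w : ℂ => w ^ (-α : ℂ)) (1 - (fourier 1 x) ^ 2) :=
      continuousAt_cpow_const hslit
    refine hca.tendsto.comp ?_
    have : Tendsto (fun m => ((r m : ℝ) : ℂ)) atTop (nhds ((1 : ℝ) : ℂ)) :=
      (Complex.continuous_ofReal.tendsto 1).comp hrt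
    have h2 := ((this.mul_const (fourier 1 x)).pow 2).const_sub 1
    simpa using h2

lemma fourierCoeff_neg_of_real {φ : 𝕋 → ℂ} (hφ : ∀ x, conj (φ x) = φ x) (n : ℤ) :
    fourierCoeff φ (-n) = conj (fourierCoeff φ n) := by
  rw [fourierCoeff, fourierCoeff, ← integral_conj]
  refine integral_congr_ae (ae_of_all _ fun x => ?_)
  simp only [smul_eq_mul, map_mul, hφ, ← fourier_neg]

/-- Parseval's identity for the Fourier coefficients of a product of two `L²` functions. -/
lemma hasSum_fourierCoeff_mul {φ F : 𝕋 → ℂ} (hφ : ∀ x, conj (φ x) = φ x)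
    (hφ2 : MemLp φ 2 ν𝕋) (hF2 : MemLp F 2 ν𝕋) (j : ℤ) :
    HasSum (fun k : ℤ => fourierCoeff φ (j - k) * fourierCoeff F k)
      (fourierCoeff (fun x => φ x * F x) j) := by
  have hψ : MemLp (fun x => fourier j x * φ x) 2 ν𝕋 := by
    refine hφ2.of_le ?_ (ae_of_all _ fun x => ?_)
    · exact ((fourier j).continuous.aestronglyMeasurable).mul hφ2.1
    · rw [norm_mul, norm_fourier_apply, one_mul]
  have h := fourierBasis.hasSum_inner_mul_inner (hψ.toLp _) (hF2.toLp _)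
  have hval : fourierCoeff (fun x => φ x * F x) j = inner ℂ (hψ.toLp _) (hF2.toLp _) := by
    rw [MeasureTheory.L2.inner_def, fourierCoeff]
    refine integral_congr_ae ?_
    filter_upwards [hψ.coeFn_toLp, hF2.coeFn_toLp] with x h1 h2
    rw [h1, h2, RCLike.inner_apply', map_mul, hφ, fourier_neg, smul_eq_mul, mul_assoc]
  rw [hval]
  refine h.congr_fun fun k => ?_
  congr 1
  · rw [← inner_conj_symm, ← HilbertBasis.repr_apply_apply, fourierBasis_repr,
      fourierCoeff_congr_ae hψ.coeFn_toLp, fourierCoeff, fourierCoeff, ← integral_conj]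
    refine integral_congr_ae (ae_of_all _ fun x => ?_)
    simp only [smul_eq_mul, map_mul, hφ, ← fourier_neg]
    rw [← mul_assoc, ← fourier_add]
    congr 3
    ring
  · rw [← HilbertBasis.repr_apply_apply, fourierBasis_repr, fourierCoeff_congr_ae hF2.coeFn_toLp]

lemma memℓp_fourierCoeff {F : 𝕋 → ℂ} (hF2 : MemLp F 2 ν𝕋) :
    Memℓp (fun k : ℕ => fourierCoeff F k) 2 := by
  have h := (memℓp_gen_iff (by norm_num)).1 (lp.memℓp (fourierBasis.repr (hF2.toLp F)))
  refine (memℓp_gen_iff (by norm_num)).2 ?_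
  refine (h.comp_injective (Nat.cast_injective (R := ℤ))).congr fun k => ?_
  simp only [Function.comp_apply]
  rw [fourierBasis_repr, fourierCoeff_congr_ae hF2.coeFn_toLp]

/-- The symbol `s |s| ^ (-4/3)` with `s = 2 sin θ`. -/
def symbol (x : 𝕋) : ℂ := ((twoSin x * |twoSin x| ^ (-(4 / 3) : ℝ) : ℝ) : ℂ)

lemma conj_symbol (x : 𝕋) : conj (symbol x) = symbol x := Complex.conj_ofReal _

lemma norm_symbol {x : 𝕋} (hx : twoSin x ≠ 0) :
    ‖symbol x‖ = |twoSin x| ^ (-(1 / 3) : ℝ) := by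
  have hpos : 0 < |twoSin x| := abs_pos.2 hx
  rw [symbol, Complex.norm_real, norm_mul, Real.norm_eq_abs, Real.norm_of_nonneg (by positivity)]
  nth_rewrite 1 [← Real.rpow_one |twoSin x|]
  rw [← Real.rpow_add hpos]
  norm_num

lemma memLp_two_of_norm_eq {F : 𝕋 → ℂ} (hF : Measurable F)
    (h : ∀ x, twoSin x ≠ 0 → ‖F x‖ = |twoSin x| ^ (-(1 / 3) : ℝ)) : MemLp F 2 ν𝕋 := by
  rw [memLp_two_iff_integrable_sq_norm hF.aestronglyMeasurable]
  refine (integrable_abs_twoSin_rpow (β := 2 / 3) (by norm_num) (by norm_num)).congr ?_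
  filter_upwards [ae_twoSin_ne_zero] with x hx
  rw [h x hx, ← Real.rpow_natCast, ← Real.rpow_mul (abs_nonneg _)]
  norm_num

lemma memLp_symbol : MemLp symbol 2 ν𝕋 := by
  refine memLp_two_of_norm_eq ?_ fun x hx => norm_symbol hx
  have := measurable_twoSin
  unfold symbol
  fun_prop

lemma memLp_K : MemLp (fun x : 𝕋 => K (1 / 3) (fourier 1 x)) 2 ν𝕋 :=
  memLp_two_of_norm_eq (measurable_K_fourier _) fun _ hx => norm_K hx

lemma symbol_mul_K {x : 𝕋} (hx : twoSin x ≠ 0) :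
    symbol x * K (1 / 3) (fourier 1 x) =
      Complex.I * conj (fourier 1 x * K (2 / 3) (fourier 1 x)) := by
  have hz := norm_fourier_apply 1 x
  have hw := one_sub_sq_eq hz
  have hK := norm_K (α := 2 / 3) hx
  have hpos : 0 < |twoSin x| := abs_pos.2 hx
  have hw0 : 1 - (fourier 1 x) ^ 2 ≠ 0 := by
    rw [← norm_ne_zero_iff, norm_one_sub_sq hz]; exact hpos.ne'
  have hprod : K (2 / 3) (fourier 1 x) * K (1 / 3) (fourier 1 x) * (1 - (fourier 1 x) ^ 2) = 1 := by
    rw [K, K, ← Complex.cpow_add _ _ hw0]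
    nth_rewrite 2 [← Complex.cpow_one (1 - (fourier 1 x) ^ 2)]
    rw [← Complex.cpow_add _ _ hw0]
    norm_num
  have hsq : ((|twoSin x| ^ (-(4 / 3) : ℝ) : ℝ) : ℂ) =
      K (2 / 3) (fourier 1 x) * conj (K (2 / 3) (fourier 1 x)) := by
    rw [Complex.mul_conj, Complex.normSq_eq_norm_sq, hK, ← Real.rpow_natCast,
      ← Real.rpow_mul (abs_nonneg _)]
    norm_num
  have hzc : fourier 1 x * conj (fourier 1 x) = 1 := by
    rw [Complex.mul_conj, Complex.normSq_eq_norm_sq, hz]; simp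
  have hs : (twoSin x : ℂ) = Complex.I * conj (fourier 1 x) * (1 - (fourier 1 x) ^ 2) := by
    rw [hw]
    change (twoSin x : ℂ) = Complex.I * _ * (-_ * ((twoSin x : ℝ) * Complex.I))
    linear_combination (-(twoSin x : ℂ)) * hzc +
      (twoSin x : ℂ) * (fourier 1 x * conj (fourier 1 x)) * Complex.I_sq
  rw [symbol, Complex.ofReal_mul, hsq, hs, map_mul]
  linear_combination Complex.I * conj (fourier 1 x) * conj (K (2 / 3) (fourier 1 x)) * hprod

lemma fourierCoeff_K (n : ℤ) (hn : n ≤ 0) :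
    fourierCoeff (fun x : 𝕋 => K (1 / 3) (fourier 1 x)) n = if n = 0 then 1 else 0 := by
  obtain ⟨m, rfl⟩ : ∃ m : ℕ, n = -m := ⟨n.natAbs, by omega⟩
  have h := integral_fourier_mul_K (α := 1 / 3) (by norm_num) (by norm_num) m
  simp only [fourierCoeff, neg_neg, fourier_natCast_mul, smul_eq_mul]
  rw [h]
  simp

lemma fourierCoeff_symbol_mul_K (j : ℕ) :
    fourierCoeff (fun x : 𝕋 => symbol x * K (1 / 3) (fourier 1 x)) ((j : ℤ) - 1) =
      if j = 0 then Complex.I else 0 := by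
  have h := integral_fourier_mul_K (α := 2 / 3) (by norm_num) (by norm_num) j
  calc _ = ∫ x, Complex.I * conj (fourier 1 x ^ j * K (2 / 3) (fourier 1 x)) ∂ν𝕋 := by
        refine integral_congr_ae ?_
        filter_upwards [ae_twoSin_ne_zero] with x hx
        have hf : fourier (-((j : ℤ) - 1)) x * conj (fourier 1 x) = conj (fourier 1 x ^ j) := by
          rw [← fourier_natCast_mul, ← fourier_neg, ← fourier_neg, ← fourier_add]
          congr 2
          ring
        rw [symbol_mul_K hx, smul_eq_mul, map_mul, map_mul, ← hf]
        ring
    _ = _ := by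
        rw [integral_const_mul, integral_conj, h]
        split_ifs <;> simp

/-- Hartman–Wintner: there is a real-valued `φ ∈ L²(𝕋)`, not a.e. zero, such that the maximal
Toeplitz operator `T_φ` has a nontrivial kernel; consequently finitely supported sequences are
not dense in `Dom T_φ` for the graph norm, i.e. `[T_φ]_max ≠ [T_φ]_min`. -/
theorem stmt_14 :
    ∃ φ : Lp ℂ 2 (haarAddCircle (T := 2 * Real.pi)),
      (∀ᵐ x ∂(haarAddCircle (T := 2 * Real.pi)), ((⇑φ) x).im = 0) ∧
      ¬ (∀ᵐ x ∂(haarAddCircle (T := 2 * Real.pi)), (⇑φ) x = 0) ∧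
      (∃ f : ellTwo, f ≠ 0 ∧ Memℓp (toeplitz (fourierCoeff ⇑φ) (⇑f)) 2 ∧
        toeplitz (fourierCoeff ⇑φ) (⇑f) = 0) ∧
      ¬ (∀ (f : ellTwo) (hf : Memℓp (toeplitz (fourierCoeff ⇑φ) (⇑f)) 2)
          (ε : ℝ), 0 < ε →
          ∃ (p : ellTwo) (_ : FinSupp (⇑p))
            (hp : Memℓp (toeplitz (fourierCoeff ⇑φ) (⇑p)) 2),
            ‖f - p‖ ^ 2 +
              ‖(⟨toeplitz (fourierCoeff ⇑φ) (⇑f), hf⟩ : ellTwo) -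
                (⟨toeplitz (fourierCoeff ⇑φ) (⇑p), hp⟩ : ellTwo)‖ ^ 2 < ε ^ 2) := by
  let φ : Lp ℂ 2 (haarAddCircle (T := 2 * Real.pi)) := memLp_symbol.toLp symbol
  have hφ : ⇑φ =ᵐ[haarAddCircle (T := 2 * Real.pi)] symbol := memLp_symbol.coeFn_toLp
  have hcoeff : fourierCoeff ⇑φ = fourierCoeff symbol := funext fun n => by
    rw [fourierCoeff_congr_ae hφ]
  let f : ellTwo := ⟨_, memℓp_fourierCoeff memLp_K⟩
  have hf0 : f 0 = 1 := (fourierCoeff_K 0 le_rfl).trans (if_pos rfl)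
  have hsum : ∀ j : ℕ, HasSum (fun k : ℕ => fourierCoeff symbol ((j : ℤ) - 1 - k) * f k)
      (if j = 0 then Complex.I else 0) := fun j => by
    rw [← fourierCoeff_symbol_mul_K]
    have h := hasSum_fourierCoeff_mul conj_symbol memLp_symbol memLp_K ((j : ℤ) - 1)
    refine ((Nat.cast_injective (R := ℤ)).hasSum_iff fun n hn => ?_).2 h
    have hneg : n < 0 := by
      by_contra! hge
      exact hn ⟨n.toNat, Int.toNat_of_nonneg hge⟩
    rw [fourierCoeff_K n hneg.le, if_neg hneg.ne, mul_zero]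
  have hker : toeplitz (fourierCoeff symbol) (⇑f) = 0 := funext fun j => by
    simpa [toeplitz] using (hsum (j + 1)).tsum_eq
  refine ⟨φ, ?_, ?_, ⟨f, ?_, ?_, ?_⟩, ?_⟩
  · filter_upwards [hφ] with x hx
    rw [hx, symbol, Complex.ofReal_im]
  · intro h0
    have hz : ∀ n, fourierCoeff symbol n = 0 := fun n => by
      rw [← hcoeff, fourierCoeff_congr_ae (g := fun _ => 0) h0]
      simp [fourierCoeff]
    have h := (hsum 0).tsum_eq
    simp only [hz, zero_mul, tsum_zero, if_true] at h
    exact Complex.I_ne_zero h.symm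
  · intro h
    rw [h] at hf0
    simp at hf0
  · rw [hcoeff, hker]
    exact zero_memℓp
  · rw [hcoeff, hker]
  · rw [hcoeff]
    exact not_dense_of_shift_kernel _ (fourierCoeff_neg_of_real conj_symbol) f (by simp [hf0]) hker
      Complex.I Complex.I_ne_zero hsum
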